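/- arXiv:1210.3596 — 5 statements merged into one kernel-verified Lean document; each statement's English description precedes it below -/
import Mathlib

section
/- Let J, γ : I → ℝ³ be differentiable on an open real interval I with γ3(t) > 0 for all t, and suppose (J, γ) solves the Goryachev system with real parameters a, b. Assume moreover that ⟨J(t), γ(t)⟩ = 0 and ⟨γ(t), γ(t)⟩ = 1 for all t ∈ I. Then the cubic integral t ↦ H2(J(t), γ(t)) = −(2/3)J3(t)·(J1(t)² + J2(t)² + (8/9)J3(t)² + (a·γ1(t)+b)·γ3(t)^(−2/3)) + a·γ3(t)^(1/3)·J1(t) is constant on I. -/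
/-- Along any solution of the Goryachev system (with `γ3 > 0`) on an
open interval, satisfying `⟨J, γ⟩ = 0` and `⟨γ, γ⟩ = 1`, the cubic integral
`H2 = −(2/3)J3(J1² + J2² + (8/9)J3² + (aγ1+b)·γ3^(−2/3)) + a·γ3^(1/3)·J1`
is constant. -/
theorem goryachev_H2_constant
    (a b α β : ℝ) (J1 J2 J3 γ1 γ2 γ3 : ℝ → ℝ)
    (hpos : ∀ t ∈ Set.Ioo α β, γ3 t > 0)
    (hJ1 : ∀ t ∈ Set.Ioo α β, HasDerivAt J1
      ((2 / 3) * J2 t * J3 t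
        - (2 / 3) * γ2 t * (a * γ1 t + b) * γ3 t ^ (-(5 : ℝ) / 3)) t)
    (hJ2 : ∀ t ∈ Set.Ioo α β, HasDerivAt J2
      (-(2 / 3) * J1 t * J3 t + a * γ3 t ^ ((1 : ℝ) / 3)
        + (2 / 3) * γ1 t * (a * γ1 t + b) * γ3 t ^ (-(5 : ℝ) / 3)) t)
    (hJ3 : ∀ t ∈ Set.Ioo α β, HasDerivAt J3
      (-(a * γ2 t * γ3 t ^ (-(2 : ℝ) / 3))) t)
    (hγ1 : ∀ t ∈ Set.Ioo α β, HasDerivAt γ1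
      (2 * ((4 / 3) * J3 t * γ2 t - J2 t * γ3 t)) t)
    (hγ2 : ∀ t ∈ Set.Ioo α β, HasDerivAt γ2
      (2 * (-(4 / 3) * J3 t * γ1 t + J1 t * γ3 t)) t)
    (hγ3 : ∀ t ∈ Set.Ioo α β, HasDerivAt γ3
      (2 * (γ1 t * J2 t - γ2 t * J1 t)) t)
    (hC1 : ∀ t ∈ Set.Ioo α β,
      J1 t * γ1 t + J2 t * γ2 t + J3 t * γ3 t = 0)
    (hC2 : ∀ t ∈ Set.Ioo α β,
      γ1 t ^ 2 + γ2 t ^ 2 + γ3 t ^ 2 = 1) :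
    ∀ s ∈ Set.Ioo α β, ∀ t ∈ Set.Ioo α β,
      -(2 / 3) * J3 s * (J1 s ^ 2 + J2 s ^ 2 + (8 / 9) * J3 s ^ 2
          + (a * γ1 s + b) * γ3 s ^ (-(2 : ℝ) / 3))
          + a * γ3 s ^ ((1 : ℝ) / 3) * J1 s
        = -(2 / 3) * J3 t * (J1 t ^ 2 + J2 t ^ 2 + (8 / 9) * J3 t ^ 2
          + (a * γ1 t + b) * γ3 t ^ (-(2 : ℝ) / 3))
          + a * γ3 t ^ ((1 : ℝ) / 3) * J1 t := by
  have key : ∀ t ∈ Set.Ioo α β, HasDerivAt (fun t =>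
      -(2 / 3) * J3 t * (J1 t ^ 2 + J2 t ^ 2 + (8 / 9) * J3 t ^ 2
          + (a * γ1 t + b) * γ3 t ^ (-(2 : ℝ) / 3))
          + a * γ3 t ^ ((1 : ℝ) / 3) * J1 t) 0 t := by
    intro t ht
    have hp := hpos t ht
    have h23 := (hγ3 t ht).rpow_const (p := -(2 : ℝ) / 3) (Or.inl hp.ne')
    have h13 := (hγ3 t ht).rpow_const (p := (1 : ℝ) / 3) (Or.inl hp.ne')
    have hK := ((((hJ1 t ht).pow 2).add ((hJ2 t ht).pow 2)).add
      (((hJ3 t ht).pow 2).const_mul (8 / 9))).add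
      ((((hγ1 t ht).const_mul a).add_const b).mul h23)
    have hH := (((hJ3 t ht).const_mul (-(2 / 3))).mul hK).add
      ((h13.const_mul a).mul (hJ1 t ht))
    refine hH.congr_deriv ?_
    have e1 : γ3 t ^ (-(2 : ℝ) / 3) = γ3 t ^ (-(5 : ℝ) / 3) * γ3 t := by
      rw [← Real.rpow_add_one hp.ne']
      norm_num
    have e2 : γ3 t ^ ((1 : ℝ) / 3) = γ3 t ^ (-(5 : ℝ) / 3) * γ3 t * γ3 t := by
      rw [← e1, ← Real.rpow_add_one hp.ne']
      norm_num
    have e3 : (-(2 : ℝ) / 3) - 1 = -(5 : ℝ) / 3 := by norm_num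
    have e4 : (1 : ℝ) / 3 - 1 = -(2 : ℝ) / 3 := by norm_num
    simp only [Pi.add_apply, Pi.mul_apply, Pi.pow_apply, e3, e4, e1, e2]
    linear_combination
      (2 / 3 * a * (γ3 t ^ (-(5 : ℝ) / 3) * γ3 t) * J2 t) * hC1 t ht
  intro s hs t ht
  exact isOpen_Ioo.is_const_of_deriv_eq_zero isPreconnected_Ioo
    (fun x hx => (key x hx).differentiableAt.differentiableWithinAt)
    (fun x hx => (key x hx).deriv) hs ht
end

section
/- Fix real parameters a, b. For every (J, γ) ∈ ℝ³ × ℝ³ with γ3 > 0, ⟨J, γ⟩ = 0 and ⟨γ, γ⟩ = 1, the e(3) Lie–Poisson bracket of H1 and H2 vanishes: ⟨J, ∇_J H1 × ∇_J H2⟩ + ⟨γ, ∇_J H1 × ∇_γ H2 + ∇_γ H1 × ∇_J H2⟩ = 0, where ∇_J, ∇_γ denote gradients in the J- and γ-variables, × is the cross product and ⟨·,·⟩ the Euclidean inner product on ℝ³. -/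
/-- The Goryachev Hamiltonian `H1`, for `γ3 > 0`. -/
noncomputable def goryachevH1 (a b : ℝ) (J γ : Fin 3 → ℝ) : ℝ :=
  J 0 ^ 2 + J 1 ^ 2 + (4 / 3) * J 2 ^ 2 + (a * γ 0 + b) * γ 2 ^ (-(2 : ℝ) / 3)

/-- The Goryachev cubic integral `H2`, for `γ3 > 0`. -/
noncomputable def goryachevH2 (a b : ℝ) (J γ : Fin 3 → ℝ) : ℝ :=
  -(2 / 3) * J 2 * (J 0 ^ 2 + J 1 ^ 2 + (8 / 9) * J 2 ^ 2
      + (a * γ 0 + b) * γ 2 ^ (-(2 : ℝ) / 3))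
    + a * γ 2 ^ ((1 : ℝ) / 3) * J 0

/-- The gradient of `F` in the `J`-variable. -/
noncomputable def gradJ (F : (Fin 3 → ℝ) → (Fin 3 → ℝ) → ℝ)
    (J γ : Fin 3 → ℝ) : Fin 3 → ℝ :=
  fun i => fderiv ℝ (fun J' => F J' γ) J (Pi.single i 1)

/-- The gradient of `F` in the `γ`-variable. -/
noncomputable def gradG (F : (Fin 3 → ℝ) → (Fin 3 → ℝ) → ℝ)
    (J γ : Fin 3 → ℝ) : Fin 3 → ℝ :=
  fun i => fderiv ℝ (fun γ' => F J γ') γ (Pi.single i 1)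

theorem gradJ_goryachevH1 (a b : ℝ) (J γ : Fin 3 → ℝ) :
    gradJ (goryachevH1 a b) J γ = ![2 * J 0, 2 * J 1, 8 / 3 * J 2] := by
  have hp := fun i : Fin 3 => hasFDerivAt_apply (𝕜 := ℝ) i J
  have h := ((((hp 0).pow 2).add ((hp 1).pow 2)).add
    (((hp 2).pow 2).const_mul (4 / 3))).add_const ((a * γ 0 + b) * γ 2 ^ (-(2 : ℝ) / 3))
  have hf : HasFDerivAt (fun J' => goryachevH1 a b J' γ) _ J := h
  ext i
  rw [gradJ, hf.fderiv]
  fin_cases i <;> simp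
  ring

theorem gradJ_goryachevH2 (a b : ℝ) (J γ : Fin 3 → ℝ) :
    gradJ (goryachevH2 a b) J γ =
      ![-(4 / 3) * J 2 * J 0 + a * γ 2 ^ ((1 : ℝ) / 3), -(4 / 3) * J 2 * J 1,
        -(2 / 3) * (J 0 ^ 2 + J 1 ^ 2 + (8 / 3) * J 2 ^ 2
          + (a * γ 0 + b) * γ 2 ^ (-(2 : ℝ) / 3))] := by
  have hp := fun i : Fin 3 => hasFDerivAt_apply (𝕜 := ℝ) i J
  have h := (((hp 2).const_mul (-(2 / 3))).mul (((((hp 0).pow 2).add ((hp 1).pow 2)).add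
    (((hp 2).pow 2).const_mul (8 / 9))).add_const ((a * γ 0 + b) * γ 2 ^ (-(2 : ℝ) / 3)))).add
    ((hp 0).const_mul (a * γ 2 ^ ((1 : ℝ) / 3)))
  have hf : HasFDerivAt (fun J' => goryachevH2 a b J' γ) _ J := h
  ext i
  rw [gradJ, hf.fderiv]
  fin_cases i <;> simp <;> ring

theorem gradG_goryachevH1 (a b : ℝ) (J γ : Fin 3 → ℝ) (hγ3 : γ 2 > 0) :
    gradG (goryachevH1 a b) J γ =
      ![a * γ 2 ^ (-(2 : ℝ) / 3), 0,
        -(2 / 3) * (a * γ 0 + b) * γ 2 ^ (-(2 : ℝ) / 3 - 1)] := by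
  have hp := fun i : Fin 3 => hasFDerivAt_apply (𝕜 := ℝ) i γ
  have h := ((((hp 0).const_mul a).add_const b).mul
    ((hp 2).rpow_const (p := -(2 : ℝ) / 3) (Or.inl hγ3.ne'))).const_add
    (J 0 ^ 2 + J 1 ^ 2 + (4 / 3) * J 2 ^ 2)
  have hf : HasFDerivAt (fun γ' => goryachevH1 a b J γ') _ γ := h
  ext i
  rw [gradG, hf.fderiv]
  fin_cases i <;> simp <;> ring

theorem gradG_goryachevH2 (a b : ℝ) (J γ : Fin 3 → ℝ) (hγ3 : γ 2 > 0) :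
    gradG (goryachevH2 a b) J γ =
      ![-(2 / 3) * J 2 * (a * γ 2 ^ (-(2 : ℝ) / 3)), 0,
        (4 / 9) * J 2 * (a * γ 0 + b) * γ 2 ^ (-(2 : ℝ) / 3 - 1)
          + (1 / 3) * a * J 0 * γ 2 ^ ((1 : ℝ) / 3 - 1)] := by
  have hp := fun i : Fin 3 => hasFDerivAt_apply (𝕜 := ℝ) i γ
  have h := (((((((hp 0).const_mul a).add_const b).mul
    ((hp 2).rpow_const (p := -(2 : ℝ) / 3) (Or.inl hγ3.ne'))).const_add
    (J 0 ^ 2 + J 1 ^ 2 + (8 / 9) * J 2 ^ 2))).const_mul (-(2 / 3) * J 2)).add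
    ((((hp 2).rpow_const (p := (1 : ℝ) / 3) (Or.inl hγ3.ne')).const_mul a).mul_const (J 0))
  have hf : HasFDerivAt (fun γ' => goryachevH2 a b J γ') _ γ := h
  ext i
  rw [gradG, hf.fderiv]
  fin_cases i <;> simp [-mul_eq_mul_left_iff] <;> ring

/-- On the invariant set `γ3 > 0`, `⟨J,γ⟩ = 0`, `⟨γ,γ⟩ = 1`, the
e(3) Lie–Poisson bracket of the Goryachev integrals `H1` and `H2` vanishes:
`⟨J, ∇_J H1 × ∇_J H2⟩ + ⟨γ, ∇_J H1 × ∇_γ H2 + ∇_γ H1 × ∇_J H2⟩ = 0`. -/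
theorem goryachev_poisson_bracket_vanishes
    (a b : ℝ) (J γ : Fin 3 → ℝ) (hγ3 : γ 2 > 0)
    (hC1 : ∑ i, J i * γ i = 0) (hC2 : ∑ i, γ i * γ i = 1) :
    (∑ i, J i *
        (crossProduct (gradJ (goryachevH1 a b) J γ)
          (gradJ (goryachevH2 a b) J γ)) i)
      + (∑ i, γ i *
          (crossProduct (gradJ (goryachevH1 a b) J γ)
              (gradG (goryachevH2 a b) J γ)
            + crossProduct (gradG (goryachevH1 a b) J γ)
              (gradJ (goryachevH2 a b) J γ)) i) = 0 := by
  have hr : γ 2 ^ ((1 : ℝ) / 3) = γ 2 ^ (-(2 : ℝ) / 3 - 1) * γ 2 ^ 2 := by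
    rw [← Real.rpow_natCast, ← Real.rpow_add hγ3]
    norm_num
  have hq : γ 2 ^ (-(2 : ℝ) / 3) = γ 2 ^ (-(2 : ℝ) / 3 - 1) * γ 2 := by
    rw [← Real.rpow_add_one hγ3.ne']
    norm_num
  have hs : γ 2 ^ ((1 : ℝ) / 3 - 1) = γ 2 ^ (-(2 : ℝ) / 3) := by norm_num
  rw [gradJ_goryachevH1, gradJ_goryachevH2, gradG_goryachevH1 a b J γ hγ3,
    gradG_goryachevH2 a b J γ hγ3, hs, hr, hq]
  generalize γ 2 ^ (-(2 : ℝ) / 3 - 1) = w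
  simp only [Fin.sum_univ_three] at hC1
  simp only [Fin.sum_univ_three, cross_apply, Pi.add_apply, Matrix.cons_val]
  linear_combination (2 / 3 * a * w * γ 2 * J 1) * hC1
end

section
/- Let a, b ∈ ℂ and λ1, λ2, μ2 ∈ ℂ be fixed with λ1, λ2, μ2 nonzero. Define Ū(λ,μ) = (λμ³ + λ⁴ + a²/4 − bλ²)/(λμ), H1(μ) = (μ·Ū(λ1,μ) − μ2·Ū(λ2,μ2))/(μ − μ2) and H2(μ) = μ·μ2·(Ū(λ1,μ) − Ū(λ2,μ2))/(μ − μ2), as functions of μ. Then for every μ1 ∈ ℂ with μ1 ≠ 0 and μ1 ≠ μ2, the derivative of H2 with respect to μ at μ1 equals (μ2/(μ1 − μ2))·(3μ1² − H1(μ1)). -/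
/-- The Stäckel potential `Ū(λ,μ)` of the separated Goryachev system. -/
noncomputable def stackelU (a b l m : ℂ) : ℂ :=
  (l * m ^ 3 + l ^ 4 + a ^ 2 / 4 - b * l ^ 2) / (l * m)

/-- Since `μ·Ū(λ,μ) = μ³ + const`, the `μ`-derivative of the potential is `(3μ² − Ū)/μ`. -/
theorem hasDerivAt_stackelU (a b : ℂ) {l m : ℂ} (hl : l ≠ 0) (hm : m ≠ 0) :
    HasDerivAt (stackelU a b l) ((3 * m ^ 2 - stackelU a b l m) / m) m := by
  have hnum : HasDerivAt (fun x : ℂ => l * x ^ 3 + l ^ 4 + a ^ 2 / 4 - b * l ^ 2)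
      (l * (3 * m ^ 2)) m := by
    simpa using ((((hasDerivAt_pow 3 m).const_mul l).add_const (l ^ 4)).add_const
      (a ^ 2 / 4)).sub_const (b * l ^ 2)
  have hden : HasDerivAt (fun x : ℂ => l * x) l m := by
    simpa using (hasDerivAt_id m).const_mul l
  refine (hnum.div hden (mul_ne_zero hl hm)).congr_deriv ?_
  unfold stackelU
  field_simp

/-- The partial derivative of the cubic Goryachev Hamiltonian
`H2(μ) = μ·μ2·(Ū(λ1,μ) − Ū(λ2,μ2))/(μ − μ2)` at `μ = μ1` equals
`(μ2/(μ1 − μ2))·(3μ1² − H1(μ1))`, where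
`H1(μ) = (μ·Ū(λ1,μ) − μ2·Ū(λ2,μ2))/(μ − μ2)`.
Here `l1, l2, m1, m2` denote `λ1, λ2, μ1, μ2`. -/
theorem goryachev_H2_partial_derivative
    (a b l1 l2 m2 : ℂ) (hl1 : l1 ≠ 0) (hl2 : l2 ≠ 0) (hm2 : m2 ≠ 0)
    (m1 : ℂ) (hm1 : m1 ≠ 0) (hne : m1 ≠ m2) :
    HasDerivAt (fun m : ℂ => m * m2 * (stackelU a b l1 m - stackelU a b l2 m2) / (m - m2))
      ((m2 / (m1 - m2)) *
        (3 * m1 ^ 2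
          - (m1 * stackelU a b l1 m1 - m2 * stackelU a b l2 m2) / (m1 - m2)))
      m1 := by
  have hsub : m1 - m2 ≠ 0 := sub_ne_zero.mpr hne
  have hnum := ((hasDerivAt_id m1).mul_const m2).mul
    ((hasDerivAt_stackelU a b hl1 hm1).sub_const (stackelU a b l2 m2))
  refine (hnum.div ((hasDerivAt_id m1).sub_const m2) hsub).congr_deriv ?_
  simp only [id_eq, Pi.mul_apply]
  field_simp
  ring
end

section
/- Let a, b, h1, h2 ∈ ℂ with a ≠ 0, and let λ1, λ2, μ1, μ2, w ∈ ℂ satisfy: λ1, λ2 ≠ 0, λ1 ≠ λ2, w ≠ 0, w² = −(μ1 − μ2)/(λ1 − λ2), and F(λᵢ,μᵢ) = λᵢ⁴ − bλᵢ² + (μᵢ³ − h1μᵢ + h2)λᵢ + a²/4 = 0 for i = 1,2. Define g₊ = (2i/a)λ1λ2(1 − w⁶), g₋ = a/(2iλ1λ2), γ1 = (g₊ − g₋)/(2i), J3 = −(3/2)(λ1μ2 − λ2μ1)/(λ1 − λ2), j₊ = −(a/2)·(λ1 + λ2)/(λ1·λ2·w), and j₋ = (j₊·g₊ + 2i·J3·w³)/g₋.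 Then j₊·j₋ + (4/3)·J3² + (a·γ1 + b)/w² = h1. -/
open Complex in
/-- The separation-of-variables expressions for the Goryachev
system reproduce the value `h1` of the Hamiltonian
`H1 = J1² + J2² + (4/3)J3² + (aγ1+b)/γ3^(2/3)`: with both pairs of separating
variables on the spectral curve `F(λ,μ) = 0`, one has
`j₊j₋ + (4/3)J3² + (aγ1 + b)/w² = h1`. Here `l1, l2, m1, m2` denote
`λ1, λ2, μ1, μ2`. -/
theorem goryachev_H1_value_in_separating_variables
    (a b h1 h2 : ℂ) (ha : a ≠ 0)
    (l1 l2 m1 m2 w : ℂ)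
    (hl1 : l1 ≠ 0) (hl2 : l2 ≠ 0) (hne : l1 ≠ l2) (hw : w ≠ 0)
    (hw2 : w ^ 2 = -((m1 - m2) / (l1 - l2)))
    (hF1 : l1 ^ 4 - b * l1 ^ 2 + (m1 ^ 3 - h1 * m1 + h2) * l1 + a ^ 2 / 4 = 0)
    (hF2 : l2 ^ 4 - b * l2 ^ 2 + (m2 ^ 3 - h1 * m2 + h2) * l2 + a ^ 2 / 4 = 0)
    (gp gm γ1 J3 jp jm : ℂ)
    (hgp : gp = (2 * I / a) * l1 * l2 * (1 - w ^ 6))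
    (hgm : gm = a / (2 * I * l1 * l2))
    (hγ1 : γ1 = (gp - gm) / (2 * I))
    (hJ3 : J3 = -((3 / 2) * (l1 * m2 - l2 * m1) / (l1 - l2)))
    (hjp : jp = -((a / 2) * (l1 + l2) / (l1 * l2 * w)))
    (hjm : jm = (jp * gp + 2 * I * J3 * w ^ 3) / gm) :
    jp * jm + (4 / 3) * J3 ^ 2 + (a * γ1 + b) / w ^ 2 = h1 := by
  have hD : l1 - l2 ≠ 0 := sub_ne_zero.mpr hne
  obtain ⟨c, hc⟩ : ∃ c, c = (l1 * m2 - l2 * m1) / (l1 - l2) := ⟨_, rfl⟩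
  have hm1 : m1 = c - w ^ 2 * l1 := by
    rw [hw2, hc]; field_simp; ring
  have hm2 : m2 = c - w ^ 2 * l2 := by
    rw [hw2, hc]; field_simp; ring
  have hJ3c : J3 = -(3 / 2 * c) := by rw [hJ3, hc]; ring
  clear hw2 hJ3 hc
  subst hm1 hm2
  have hcurve : 4 * (l1 * l2) * (h1 * w ^ 2) =
      4 * (l1 * l2) * (b - (1 - w ^ 6) * ((l1 + l2) ^ 2 - l1 * l2)
        - 3 * w ^ 4 * c * (l1 + l2) + 3 * w ^ 2 * c ^ 2) + a ^ 2 := by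
    apply mul_left_cancel₀ hD
    linear_combination 4 * l2 * hF1 - 4 * l1 * hF2
  have hγ : a * γ1 = l1 * l2 * (1 - w ^ 6) + a ^ 2 / (4 * (l1 * l2)) := by
    rw [hγ1, hgp, hgm]
    field_simp
    linear_combination (-4 * a ^ 2) * I_sq
  have hj : jp * jm * w ^ 2 =
      -((l1 + l2) ^ 2 * (1 - w ^ 6)) - 3 * (l1 + l2) * c * w ^ 4 := by
    rw [hjm, hgm, hjp, hgp, hJ3c]
    field_simp
    rw [I_sq]
    ring
  apply mul_right_cancel₀ (pow_ne_zero 2 hw)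
  rw [add_mul, add_mul, div_mul_cancel₀ _ (pow_ne_zero 2 hw), hj, hγ, hJ3c]
  field_simp
  linear_combination -4 * hcurve
end

section
/- Let a, b, h1, h2 ∈ ℂ with a ≠ 0, and let λ1, λ2, μ1, μ2, w ∈ ℂ satisfy: λ1, λ2 ≠ 0, λ1 ≠ λ2, w ≠ 0, w² = −(μ1 − μ2)/(λ1 − λ2), and F(λᵢ,μᵢ) = λᵢ⁴ − bλᵢ² + (μᵢ³ − h1μᵢ + h2)λᵢ + a²/4 = 0 for i = 1,2. Define g₊ = (2i/a)λ1λ2(1 − w⁶), g₋ = a/(2iλ1λ2), γ1 = (g₊ − g₋)/(2i), J3 = −(3/2)(λ1μ2 − λ2μ1)/(λ1 − λ2), j₊ = −(a/2)·(λ1 + λ2)/(λ1·λ2·w), j₋ = (j₊·g₊ + 2i·J3·w³)/g₋, and J1 = (j₊ + j₋)/2. Then −(2/3)·J3·(j₊·j₋ + (8/9)·J3² + (a·γ1 + b)/w²) + a·w·J1 = h2. -/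
open Complex in
/-- The separation-of-variables expressions for the Goryachev
system reproduce the value `h2` of the cubic integral
`H2 = −(2/3)J3(J1² + J2² + (8/9)J3² + (aγ1+b)/γ3^(2/3)) + a·γ3^(1/3)·J1`:
with both pairs of separating variables on the spectral curve `F(λ,μ) = 0`,
one has `−(2/3)J3(j₊j₋ + (8/9)J3² + (aγ1 + b)/w²) + a·w·J1 = h2`.
Here `l1, l2, m1, m2` denote `λ1, λ2, μ1, μ2`. -/
theorem goryachev_H2_value_in_separating_variables
    (a b h1 h2 : ℂ) (ha : a ≠ 0)
    (l1 l2 m1 m2 w : ℂ)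
    (hl1 : l1 ≠ 0) (hl2 : l2 ≠ 0) (hne : l1 ≠ l2) (hw : w ≠ 0)
    (hw2 : w ^ 2 = -((m1 - m2) / (l1 - l2)))
    (hF1 : l1 ^ 4 - b * l1 ^ 2 + (m1 ^ 3 - h1 * m1 + h2) * l1 + a ^ 2 / 4 = 0)
    (hF2 : l2 ^ 4 - b * l2 ^ 2 + (m2 ^ 3 - h1 * m2 + h2) * l2 + a ^ 2 / 4 = 0)
    (gp gm γ1 J3 jp jm J1 : ℂ)
    (hgp : gp = (2 * I / a) * l1 * l2 * (1 - w ^ 6))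
    (hgm : gm = a / (2 * I * l1 * l2))
    (hγ1 : γ1 = (gp - gm) / (2 * I))
    (hJ3 : J3 = -((3 / 2) * (l1 * m2 - l2 * m1) / (l1 - l2)))
    (hjp : jp = -((a / 2) * (l1 + l2) / (l1 * l2 * w)))
    (hjm : jm = (jp * gp + 2 * I * J3 * w ^ 3) / gm)
    (hJ1 : J1 = (jp + jm) / 2) :
    -(2 / 3) * J3 * (jp * jm + (8 / 9) * J3 ^ 2 + (a * γ1 + b) / w ^ 2)
      + a * w * J1 = h2 := by
  have hd : l1 - l2 ≠ 0 := sub_ne_zero.mpr hne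
  obtain ⟨v, hv⟩ : ∃ v, v = (l1 * m2 - l2 * m1) / (l1 - l2) := ⟨_, rfl⟩
  have hm1 : m1 = v - w ^ 2 * l1 := by
    rw [hv, hw2]; field_simp; ring
  have hm2 : m2 = v - w ^ 2 * l2 := by
    rw [hv, hw2]; field_simp; ring
  have hJ3v : J3 = -(3 / 2) * v := by
    rw [hJ3, hv]; ring
  have hjm' : jm = 2 * l1 * l2 * (l1 + l2) * (1 - w ^ 6) / (a * w)
      + 6 * v * w ^ 3 * l1 * l2 / a := by
    rw [hjm, hgm, hgp, hjp, hJ3v]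
    field_simp
    simp only [I_sq]
    ring
  have hγ : a * γ1 = l1 * l2 * (1 - w ^ 6) + a ^ 2 / (4 * l1 * l2) := by
    rw [hγ1, hgp, hgm]
    field_simp
    simp only [I_sq]
    ring
  rw [hJ1, hγ, hjm', hjp, hJ3v]
  clear hv hw2 hJ1 hγ hjm' hjm hjp hJ3v hJ3 hγ1 hgp hgm
  subst hm1 hm2
  linear_combination (norm := (field_simp; ring))
    (-(v - w ^ 2 * l2) / (w ^ 2 * (l1 - l2) * l1)) * hF1
      + ((v - w ^ 2 * l1) / (w ^ 2 * (l1 - l2) * l2)) * hF2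
end
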